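/- Let (A, ·, α) be a Hom-pre-Lie algebra over a field K of characteristic zero equipped with an action of a finite group G, and suppose the second equivariant α-type cohomology of A vanishes: every invariant family {(ν'^H, α'^H)}_{H≤G} of 2-cocycles (for each H, ∂̃_{νν}ν'^H − ∂̃_{αν}α'^H = 0 and ∂̃_{να}ν'^H − ∂̃_{αα}α'^H = 0 on A^H) is an invariant 2-coboundary (there exists an invariant family of linear maps φ^H : A^H → A^H with ν'^H = ∂̃_{νν}φ^H and α'^H = ∂̃_{να}φ^H for every H). Then A is equivariantly rigid: every equivariant formal deformation of A is equivalent, through an equivariant equivalence, to the trivial equivariant deformation. -/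

import Mathlib

open Finset

/-- A Hom-pre-Lie algebra over a field `K`. -/
structure HomPreLieStr (K A : Type) [Field K] [AddCommGroup A] [Module K A] where
  mul : A →ₗ[K] A →ₗ[K] A
  alpha : A →ₗ[K] A
  homPreLie : ∀ a b c : A,
    mul (mul a b) (alpha c) - mul (alpha a) (mul b c)
      = mul (mul b a) (alpha c) - mul (alpha b) (mul a c)
  alpha_mult : ∀ a b : A, alpha (mul a b) = mul (alpha a) (alpha b)

section LowDiff

variable {K A : Type} [Field K] [AddCommGroup A] [Module K A]

/-- `∂̃_{νν}` of a bilinear 2-cochain (regular coefficients). -/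
def Dnn2 (S : HomPreLieStr K A) (f : A →ₗ[K] A →ₗ[K] A) (a b c : A) : A :=
  S.mul (S.alpha a) (f b c) - S.mul (S.alpha b) (f a c)
    + S.mul (f b a) (S.alpha c) - S.mul (f a b) (S.alpha c)
    - f (S.alpha b) (S.mul a c) + f (S.alpha a) (S.mul b c)
    - f (S.mul a b) (S.alpha c) + f (S.mul b a) (S.alpha c)

/-- `∂̃_{αν}` of a linear 1-cochain (regular coefficients). -/
def Dan2 (S : HomPreLieStr K A) (g : A →ₗ[K] A) (a b c : A) : A :=
  S.mul (g b) (S.mul a c) - S.mul (g a) (S.mul b c)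
    + S.mul (S.mul a b) (g c) - S.mul (S.mul b a) (g c)

/-- `∂̃_{να}` of a bilinear 2-cochain (regular coefficients). -/
def Dna2 (S : HomPreLieStr K A) (f : A →ₗ[K] A →ₗ[K] A) (a b : A) : A :=
  S.alpha (f a b) - f (S.alpha a) (S.alpha b)

/-- `∂̃_{αα}` of a linear 1-cochain (regular coefficients). -/
def Daa2 (S : HomPreLieStr K A) (g : A →ₗ[K] A) (a b : A) : A :=
  S.mul (S.alpha a) (g b) + S.mul (g a) (S.alpha b) - g (S.mul a b)

/-- `∂̃_{νν}` of a linear 1-cochain (regular coefficients). -/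
def Dnn1 (S : HomPreLieStr K A) (g : A →ₗ[K] A) (a b : A) : A :=
  S.mul a (g b) + S.mul (g a) b - g (S.mul a b)

/-- `∂̃_{να}` of a linear 1-cochain (regular coefficients). -/
def Dna1 (S : HomPreLieStr K A) (g : A →ₗ[K] A) (a : A) : A :=
  S.alpha (g a) - g (S.alpha a)

end LowDiff

/-- A one-parameter formal deformation `(ν_t, α_t)` of a Hom-pre-Lie algebra,
given by the coefficient sequences `ν_i` (bilinear) and `α_i` (linear), with
`ν₀ = ·`, `α₀ = α`, satisfying the deformation equations in each order `n`. -/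
structure FormalDef {K A : Type} [Field K] [AddCommGroup A] [Module K A]
    (S : HomPreLieStr K A) where
  nu : ℕ → (A →ₗ[K] A →ₗ[K] A)
  al : ℕ → (A →ₗ[K] A)
  nu_zero : ∀ a b : A, nu 0 a b = S.mul a b
  al_zero : ∀ a : A, al 0 a = S.alpha a
  deform : ∀ (n : ℕ) (a b c : A),
    (∑ i ∈ Finset.range (n + 1), ∑ j ∈ Finset.range (n + 1 - i),
      (nu i (nu j a b) (al (n - i - j) c) - nu i (al j a) (nu (n - i - j) b c)
        - nu i (nu j b a) (al (n - i - j) c) + nu i (al j b) (nu (n - i - j) a c))) = 0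
  deform_alpha : ∀ (n : ℕ) (a b : A),
    (∑ i ∈ Finset.range (n + 1), ∑ j ∈ Finset.range (n + 1 - i),
      nu i (al j a) (al (n - i - j) b))
      = ∑ i ∈ Finset.range (n + 1), al i (nu (n - i) a b)

/-- A deformation of order `n` of a Hom-pre-Lie algebra: the deformation
equations hold in all orders `m ≤ n`. -/
def IsDefOrder {K A : Type} [Field K] [AddCommGroup A] [Module K A]
    (S : HomPreLieStr K A) (nu : ℕ → (A →ₗ[K] A →ₗ[K] A))
    (al : ℕ → (A →ₗ[K] A)) (n : ℕ) : Prop :=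
  (∀ a b : A, nu 0 a b = S.mul a b) ∧ (∀ a : A, al 0 a = S.alpha a) ∧
  (∀ m ≤ n, ∀ a b c : A,
    (∑ i ∈ Finset.range (m + 1), ∑ j ∈ Finset.range (m + 1 - i),
      (nu i (nu j a b) (al (m - i - j) c) - nu i (al j a) (nu (m - i - j) b c)
        - nu i (nu j b a) (al (m - i - j) c) + nu i (al j b) (nu (m - i - j) a c))) = 0) ∧
  (∀ m ≤ n, ∀ a b : A,
    (∑ i ∈ Finset.range (m + 1), ∑ j ∈ Finset.range (m + 1 - i),
      nu i (al j a) (al (m - i - j) b))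
      = ∑ i ∈ Finset.range (m + 1), al i (nu (m - i) a b))

/-- The `ν`-component `Oⁿ_ν` of the obstruction of an order-`n` deformation:
the sum over `i+j+k = n+1` with `0 ≤ i,j,k ≤ n` of the associator terms. -/
def obsNu {K A : Type} [Field K] [AddCommGroup A] [Module K A]
    (nu : ℕ → (A →ₗ[K] A →ₗ[K] A)) (al : ℕ → (A →ₗ[K] A))
    (n : ℕ) (a b c : A) : A :=
  ∑ i ∈ Finset.range (n + 1), ∑ j ∈ Finset.range (n + 1),
    if i + j ≤ n + 1 ∧ n + 1 - i - j ≤ n then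
      (nu i (nu j a b) (al (n + 1 - i - j) c)
        - nu i (al (n + 1 - i - j) a) (nu j b c)
        - nu i (nu j b a) (al (n + 1 - i - j) c)
        + nu i (al (n + 1 - i - j) b) (nu j a c))
    else 0

/-- The `α`-component `Oⁿ_α` of the obstruction of an order-`n` deformation. -/
def obsAl {K A : Type} [Field K] [AddCommGroup A] [Module K A]
    (nu : ℕ → (A →ₗ[K] A →ₗ[K] A)) (al : ℕ → (A →ₗ[K] A))
    (n : ℕ) (a b : A) : A :=
  (∑ i ∈ Finset.range (n + 1), ∑ j ∈ Finset.range (n + 1),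
    if i + j ≤ n + 1 ∧ n + 1 - i - j ≤ n then
      nu i (al j a) (al (n + 1 - i - j) b)
    else 0)
  - ∑ i ∈ Finset.Icc 1 n, al i (nu (n + 1 - i) a b)

/-- Equivalence of two formal deformations via a formal isomorphism
`Ψ_t = Σ ψ_i t^i` with `ψ₀ = id`:
`Ψ_t ∘ ν'_t = ν_t ∘ (Ψ_t ⊗ Ψ_t)` and `α_t ∘ Ψ_t = Ψ_t ∘ α'_t`. -/
def AreEquiv {K A : Type} [Field K] [AddCommGroup A] [Module K A]
    {S : HomPreLieStr K A} (D D' : FormalDef S) (ψ : ℕ → (A →ₗ[K] A)) : Prop :=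
  (∀ a : A, ψ 0 a = a) ∧
  (∀ (n : ℕ) (a b : A),
    (∑ i ∈ Finset.range (n + 1), ψ i (D'.nu (n - i) a b))
      = ∑ i ∈ Finset.range (n + 1), ∑ j ∈ Finset.range (n + 1 - i),
          D.nu i (ψ j a) (ψ (n - i - j) b)) ∧
  (∀ (n : ℕ) (a : A),
    (∑ i ∈ Finset.range (n + 1), D.al i (ψ (n - i) a))
      = ∑ i ∈ Finset.range (n + 1), ψ i (D'.al (n - i) a))

/-- An action of a group `G` on a Hom-pre-Lie algebra `(A,·,α)` by linear
automorphisms preserving the product and commuting with `α`. -/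
structure HPLAction {K A : Type} [Field K] [AddCommGroup A] [Module K A]
    (S : HomPreLieStr K A) (G : Type) [Group G] where
  psi : G →* (A ≃ₗ[K] A)
  psi_mul : ∀ (g : G) (a b : A), psi g (S.mul a b) = S.mul (psi g a) (psi g b)
  psi_alpha : ∀ (g : G) (a : A), S.alpha (psi g a) = psi g (S.alpha a)

/-- The `H`-fixed point set `A^H` of the action, for a subgroup `H ≤ G`. -/
def HPLAction.fx {K A : Type} [Field K] [AddCommGroup A] [Module K A]
    {S : HomPreLieStr K A} {G : Type} [Group G] (act : HPLAction S G)
    (H : Subgroup G) : Set A :=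
  {a : A | ∀ h ∈ H, act.psi h a = a}

/-- An equivariant one-parameter formal deformation of a Hom-pre-Lie algebra `A`
equipped with an action of `G`: for each subgroup `H ≤ G`, sequences of bilinear
maps `ν^H_i` and linear maps `α^H_i` (encoded as maps on `A` preserving the
fixed-point subalgebra `A^H`), restricting to `·` and `α` in order zero,
satisfying the deformation equations on `A^H` in every order, and compatible
with the maps `ψ_g` attached to subconjugacy relations `g⁻¹Hg ⊆ K'`. -/
structure EquivFormalDef {K A : Type} [Field K] [AddCommGroup A] [Module K A]
    (S : HomPreLieStr K A) {G : Type} [Group G] (act : HPLAction S G) where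
  nu : Subgroup G → ℕ → (A →ₗ[K] A →ₗ[K] A)
  al : Subgroup G → ℕ → (A →ₗ[K] A)
  nu_zero : ∀ (H : Subgroup G) (a b : A), a ∈ act.fx H → b ∈ act.fx H →
    nu H 0 a b = S.mul a b
  al_zero : ∀ (H : Subgroup G) (a : A), a ∈ act.fx H → al H 0 a = S.alpha a
  maps_nu : ∀ (H : Subgroup G) (i : ℕ) (a b : A), a ∈ act.fx H → b ∈ act.fx H →
    nu H i a b ∈ act.fx H
  maps_al : ∀ (H : Subgroup G) (i : ℕ) (a : A), a ∈ act.fx H → al H i a ∈ act.fx H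
  deform : ∀ (H : Subgroup G) (n : ℕ) (a b c : A),
    a ∈ act.fx H → b ∈ act.fx H → c ∈ act.fx H →
    (∑ i ∈ Finset.range (n + 1), ∑ j ∈ Finset.range (n + 1 - i),
      (nu H i (nu H j a b) (al H (n - i - j) c)
        - nu H i (al H j a) (nu H (n - i - j) b c)
        - nu H i (nu H j b a) (al H (n - i - j) c)
        + nu H i (al H j b) (nu H (n - i - j) a c))) = 0
  deform_alpha : ∀ (H : Subgroup G) (n : ℕ) (a b : A),
    a ∈ act.fx H → b ∈ act.fx H →
    (∑ i ∈ Finset.range (n + 1), ∑ j ∈ Finset.range (n + 1 - i),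
      nu H i (al H j a) (al H (n - i - j) b))
      = ∑ i ∈ Finset.range (n + 1), al H i (nu H (n - i) a b)
  equivar_nu : ∀ (g : G) (H K' : Subgroup G), (∀ h ∈ H, g⁻¹ * h * g ∈ K') →
    ∀ (i : ℕ) (a b : A), a ∈ act.fx K' → b ∈ act.fx K' →
      nu H i (act.psi g a) (act.psi g b) = act.psi g (nu K' i a b)
  equivar_al : ∀ (g : G) (H K' : Subgroup G), (∀ h ∈ H, g⁻¹ * h * g ∈ K') →
    ∀ (i : ℕ) (a : A), a ∈ act.fx K' →
      al H i (act.psi g a) = act.psi g (al K' i a)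

/-- An equivariant deformation of order `n`. -/
def IsEquivDefOrder {K A : Type} [Field K] [AddCommGroup A] [Module K A]
    (S : HomPreLieStr K A) {G : Type} [Group G] (act : HPLAction S G)
    (nu : Subgroup G → ℕ → (A →ₗ[K] A →ₗ[K] A))
    (al : Subgroup G → ℕ → (A →ₗ[K] A)) (n : ℕ) : Prop :=
  (∀ (H : Subgroup G) (a b : A), a ∈ act.fx H → b ∈ act.fx H →
    nu H 0 a b = S.mul a b) ∧
  (∀ (H : Subgroup G) (a : A), a ∈ act.fx H → al H 0 a = S.alpha a) ∧
  (∀ (H : Subgroup G) (i : ℕ) (a b : A), a ∈ act.fx H → b ∈ act.fx H →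
    nu H i a b ∈ act.fx H) ∧
  (∀ (H : Subgroup G) (i : ℕ) (a : A), a ∈ act.fx H → al H i a ∈ act.fx H) ∧
  (∀ (H : Subgroup G), ∀ m ≤ n, ∀ a b c : A,
    a ∈ act.fx H → b ∈ act.fx H → c ∈ act.fx H →
    (∑ i ∈ Finset.range (m + 1), ∑ j ∈ Finset.range (m + 1 - i),
      (nu H i (nu H j a b) (al H (m - i - j) c)
        - nu H i (al H j a) (nu H (m - i - j) b c)
        - nu H i (nu H j b a) (al H (m - i - j) c)
        + nu H i (al H j b) (nu H (m - i - j) a c))) = 0) ∧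
  (∀ (H : Subgroup G), ∀ m ≤ n, ∀ a b : A, a ∈ act.fx H → b ∈ act.fx H →
    (∑ i ∈ Finset.range (m + 1), ∑ j ∈ Finset.range (m + 1 - i),
      nu H i (al H j a) (al H (m - i - j) b))
      = ∑ i ∈ Finset.range (m + 1), al H i (nu H (m - i) a b)) ∧
  (∀ (g : G) (H K' : Subgroup G), (∀ h ∈ H, g⁻¹ * h * g ∈ K') →
    ∀ i ≤ n, ∀ a b : A, a ∈ act.fx K' → b ∈ act.fx K' →
      nu H i (act.psi g a) (act.psi g b) = act.psi g (nu K' i a b)) ∧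
  (∀ (g : G) (H K' : Subgroup G), (∀ h ∈ H, g⁻¹ * h * g ∈ K') →
    ∀ i ≤ n, ∀ a : A, a ∈ act.fx K' →
      al H i (act.psi g a) = act.psi g (al K' i a))

/-- Equivalence of two equivariant formal deformations via a family of formal
isomorphisms `Ψ^H_t = Σ ψ^H_i t^i` with `ψ^H₀ = id` on `A^H`. -/
def EquivAreEquiv {K A : Type} [Field K] [AddCommGroup A] [Module K A]
    {S : HomPreLieStr K A} {G : Type} [Group G] {act : HPLAction S G}
    (D D' : EquivFormalDef S act)
    (Ψ : Subgroup G → ℕ → (A →ₗ[K] A)) : Prop :=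
  (∀ (H : Subgroup G) (a : A), a ∈ act.fx H → Ψ H 0 a = a) ∧
  (∀ (H : Subgroup G) (n : ℕ) (a b : A), a ∈ act.fx H → b ∈ act.fx H →
    (∑ i ∈ Finset.range (n + 1), Ψ H i (D'.nu H (n - i) a b))
      = ∑ i ∈ Finset.range (n + 1), ∑ j ∈ Finset.range (n + 1 - i),
          D.nu H i (Ψ H j a) (Ψ H (n - i - j) b)) ∧
  (∀ (H : Subgroup G) (n : ℕ) (a : A), a ∈ act.fx H →
    (∑ i ∈ Finset.range (n + 1), D.al H i (Ψ H (n - i) a))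
      = ∑ i ∈ Finset.range (n + 1), Ψ H i (D'.al H (n - i) a))

section FormalSeries

variable {K A : Type} [Field K] [AddCommGroup A] [Module K A]

/-- The coefficient of `t^n` in `ν_t(x_t, y_t)`. -/
def seriesMul (ν : ℕ → (A →ₗ[K] A →ₗ[K] A)) (x y : ℕ → A) (n : ℕ) : A :=
  ∑ i ∈ range (n + 1), ∑ j ∈ range (n + 1 - i), ν i (x j) (y (n - i - j))

/-- The coefficient of `t^n` in `α_t(x_t)`. -/
def seriesApply (α : ℕ → (A →ₗ[K] A)) (x : ℕ → A) (n : ℕ) : A :=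
  ∑ i ∈ range (n + 1), α i (x (n - i))

theorem sum_range_eq_box {M : Type*} [AddCommMonoid M] {n N : ℕ} (h : n < N) (F : ℕ → ℕ → M) :
    ∑ i ∈ range (n + 1), F i (n - i)
      = ∑ i ∈ range N, ∑ j ∈ range N, if i + j = n then F i j else 0 := by
  rw [← sum_subset (range_subset_range.2 (Nat.succ_le_of_lt h))]
  · refine sum_congr rfl fun i hi => ?_
    rw [mem_range] at hi
    rw [sum_eq_single (n - i)]
    · rw [if_pos (by omega)]
    · intro j _ hj
      rw [if_neg (by omega)]
    · intro hj
      rw [mem_range] at hj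
      omega
  · intro i _ hi
    rw [mem_range] at hi
    exact sum_eq_zero fun j _ => if_neg (by omega)

theorem sum_range_range_eq_box {M : Type*} [AddCommMonoid M] {n N : ℕ} (h : n < N)
    (F : ℕ → ℕ → ℕ → M) :
    ∑ i ∈ range (n + 1), ∑ j ∈ range (n + 1 - i), F i j (n - i - j)
      = ∑ i ∈ range N, ∑ j ∈ range N, ∑ k ∈ range N, if i + j + k = n then F i j k else 0 := by
  rw [← sum_subset (range_subset_range.2 (Nat.succ_le_of_lt h))]
  · refine sum_congr rfl fun i hi => ?_
    rw [mem_range] at hi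
    rw [Nat.succ_sub (by omega), sum_range_eq_box (N := N) (by omega)]
    refine sum_congr rfl fun j _ => sum_congr rfl fun k _ => ?_
    exact if_congr (by omega) rfl rfl
  · intro i _ hi
    rw [mem_range] at hi
    exact sum_eq_zero fun j _ => sum_eq_zero fun k _ => if_neg (by omega)

theorem sum_ite_const_zero {ι M : Type*} [AddCommMonoid M] (I : Finset ι) (p : Prop) [Decidable p]
    (f : ι → M) : (∑ s ∈ I, if p then f s else 0) = if p then ∑ s ∈ I, f s else 0 := by
  split_ifs <;> simp

theorem seriesMul_congr {ν : ℕ → (A →ₗ[K] A →ₗ[K] A)} {x x' y y' : ℕ → A} {n : ℕ}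
    (hx : ∀ m ≤ n, x m = x' m) (hy : ∀ m ≤ n, y m = y' m) :
    seriesMul ν x y n = seriesMul ν x' y' n := by
  refine sum_congr rfl fun i hi => sum_congr rfl fun j hj => ?_
  rw [mem_range] at hi hj
  rw [hx j (by omega), hy _ (by omega)]

theorem seriesApply_congr {α : ℕ → (A →ₗ[K] A)} {x x' : ℕ → A} {n : ℕ}
    (hx : ∀ m ≤ n, x m = x' m) : seriesApply α x n = seriesApply α x' n := by
  refine sum_congr rfl fun i hi => ?_
  rw [hx _ (by omega)]

/-- Changing the top coefficients of the arguments changes the top coefficient of `ν_t(x_t, y_t)`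
by terms involving `ν₀` only. -/
theorem seriesMul_eq_add {ν : ℕ → (A →ₗ[K] A →ₗ[K] A)} {x x' y y' : ℕ → A} {n : ℕ} (hn : n ≠ 0)
    (hx : ∀ m < n, x m = x' m) (hy : ∀ m < n, y m = y' m) :
    seriesMul ν x y n = seriesMul ν x' y' n
      + ν 0 (x n - x' n) (y' 0) + ν 0 (x' 0) (y n - y' n) := by
  have key : ∀ i ∈ range (n + 1), ∑ j ∈ range (n + 1 - i), ν i (x j) (y (n - i - j))
      = ∑ j ∈ range (n + 1 - i), ν i (x' j) (y' (n - i - j))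
        + if i = 0 then ν 0 (x n - x' n) (y' 0) + ν 0 (x' 0) (y n - y' n) else 0 := by
    intro i hi
    rw [mem_range] at hi
    rcases Nat.eq_zero_or_pos i with rfl | hpos
    · obtain ⟨k, rfl⟩ := Nat.exists_eq_succ_of_ne_zero hn
      simp only [Nat.sub_zero, if_true, Nat.succ_eq_add_one]
      rw [sum_range_succ, sum_range_succ', sum_range_succ _ (k + 1), sum_range_succ' _ k]
      have : ∀ j ∈ range k, ν 0 (x (j + 1)) (y (k + 1 - (j + 1)))
          = ν 0 (x' (j + 1)) (y' (k + 1 - (j + 1))) := by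
        intro j hj
        rw [mem_range] at hj
        rw [hx _ (by omega), hy _ (by omega)]
      rw [sum_congr rfl this, hx 0 (by omega)]
      simp only [Nat.sub_zero, Nat.sub_self, map_sub, LinearMap.sub_apply]
      rw [hy 0 (by omega)]
      abel
    · rw [if_neg hpos.ne', add_zero]
      refine sum_congr rfl fun j hj => ?_
      rw [mem_range] at hj
      rw [hx _ (by omega), hy _ (by omega)]
  rw [seriesMul, sum_congr rfl key, sum_add_distrib, seriesMul, add_assoc]
  simp

theorem seriesApply_eq_add {α : ℕ → (A →ₗ[K] A)} {x x' : ℕ → A} {n : ℕ}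
    (hx : ∀ m < n, x m = x' m) :
    seriesApply α x n = seriesApply α x' n + α 0 (x n - x' n) := by
  have key : ∀ i ∈ range n, α (i + 1) (x (n - (i + 1))) = α (i + 1) (x' (n - (i + 1))) := by
    intro i hi
    rw [mem_range] at hi
    rw [hx _ (by omega)]
  rw [seriesApply, seriesApply, sum_range_succ', sum_range_succ', sum_congr rfl key]
  simp only [Nat.sub_zero, map_sub]
  abel

/-- `ν_t(x_t, y_t)` for series given as sums of monomials `f ι t^{d ι}` and `g κ t^{e κ}`. -/
theorem seriesMul_eq_sum_family {ι κ : Type*} {ν : ℕ → (A →ₗ[K] A →ₗ[K] A)} {x y : ℕ → A}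
    {n N : ℕ} (h : n < N) {I : Finset ι} {J : Finset κ} {d : ι → ℕ} {e : κ → ℕ}
    {f : ι → A} {g : κ → A}
    (hx : ∀ m < N, x m = ∑ s ∈ I, if d s = m then f s else 0)
    (hy : ∀ m < N, y m = ∑ s ∈ J, if e s = m then g s else 0) :
    seriesMul ν x y n = ∑ i ∈ range N, ∑ s ∈ I, ∑ t ∈ J,
      if i + d s + e t = n then ν i (f s) (g t) else 0 := by
  rw [seriesMul, sum_range_range_eq_box h (fun i j k => ν i (x j) (y k))]
  refine sum_congr rfl fun i _ => ?_
  have expand : ∀ u ∈ range N, ∀ v ∈ range N, (if i + u + v = n then ν i (x u) (y v) else 0)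
      = ∑ s ∈ I, ∑ t ∈ J, if d s = u then if e t = v then
          if i + d s + e t = n then ν i (f s) (g t) else 0 else 0 else 0 := by
    intro u hu v hv
    rw [hx u (mem_range.1 hu), hy v (mem_range.1 hv), map_sum (ν i), LinearMap.sum_apply,
      ← sum_ite_const_zero]
    refine sum_congr rfl fun s _ => ?_
    rw [map_sum (ν i _), ← sum_ite_const_zero]
    refine sum_congr rfl fun t _ => ?_
    by_cases hs : d s = u
    · by_cases ht : e t = v <;> simp [hs, ht]
    · simp [hs]
  calc _ = ∑ u ∈ range N, ∑ v ∈ range N, ∑ s ∈ I, ∑ t ∈ J, (if d s = u then if e t = v then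
          if i + d s + e t = n then ν i (f s) (g t) else 0 else 0 else 0) :=
        sum_congr rfl fun u hu => sum_congr rfl fun v hv => expand u hu v hv
    _ = ∑ s ∈ I, ∑ t ∈ J, ∑ u ∈ range N, ∑ v ∈ range N, (if d s = u then if e t = v then
          if i + d s + e t = n then ν i (f s) (g t) else 0 else 0 else 0) := by
        simp_rw [← sum_product' (range N) (range N), ← sum_product' I J]
        rw [sum_comm]
    _ = _ := by
        refine sum_congr rfl fun s _ => sum_congr rfl fun t _ => ?_
        by_cases hst : i + d s + e t = n
        · have hs : d s ∈ range N := mem_range.2 (by omega)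
          have ht : e t ∈ range N := mem_range.2 (by omega)
          simp only [hst, if_true]
          rw [sum_eq_single_of_mem (d s) hs (fun u _ hu => by simp [hu.symm]),
            sum_eq_single_of_mem (e t) ht (fun u _ hu => by simp [hu.symm])]
          simp
        · simp [hst]

theorem seriesApply_eq_sum_family {ι : Type*} {α : ℕ → (A →ₗ[K] A)} {x : ℕ → A}
    {n N : ℕ} (h : n < N) {I : Finset ι} {d : ι → ℕ} {f : ι → A}
    (hx : ∀ m < N, x m = ∑ s ∈ I, if d s = m then f s else 0) :
    seriesApply α x n = ∑ i ∈ range N, ∑ s ∈ I, if i + d s = n then α i (f s) else 0 := by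
  rw [seriesApply, sum_range_eq_box h (fun i j => α i (x j))]
  refine sum_congr rfl fun i _ => ?_
  calc _ = ∑ u ∈ range N, ∑ s ∈ I, (if d s = u then
          if i + d s = n then α i (f s) else 0 else 0) := by
        refine sum_congr rfl fun u hu => ?_
        rw [hx u (mem_range.1 hu), map_sum]
        split_ifs with hun
        · refine sum_congr rfl fun s _ => ?_
          by_cases hs : d s = u
          · simp [hs, hun]
          · simp [hs]
        · refine (sum_eq_zero fun s _ => ?_).symm
          by_cases hs : d s = u
          · simp [hs, hun]
          · simp [hs]
    _ = _ := by
        rw [sum_comm]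
        refine sum_congr rfl fun s _ => ?_
        by_cases hs : i + d s = n
        · rw [sum_eq_single_of_mem (d s) (mem_range.2 (by omega))
            (fun u _ hu => by simp [hu.symm])]
          simp
        · simp [hs]

/-- The triples of natural numbers smaller than `N`. -/
def box3 (N : ℕ) : Finset (ℕ × ℕ × ℕ) := range N ×ˢ range N ×ˢ range N

theorem seriesMul_eq_sum_box3 {ν : ℕ → (A →ₗ[K] A →ₗ[K] A)} {m N : ℕ} (h : m < N) (x y : ℕ → A) :
    seriesMul ν x y m = ∑ s ∈ box3 N,
      if s.1 + s.2.1 + s.2.2 = m then ν s.1 (x s.2.1) (y s.2.2) else 0 := by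
  rw [seriesMul, sum_range_range_eq_box h (fun i j k => ν i (x j) (y k))]
  simp only [box3, sum_product]

theorem seriesApply_eq_sum_box {α : ℕ → (A →ₗ[K] A)} {m N : ℕ} (h : m < N) (x : ℕ → A) :
    seriesApply α x m = ∑ s ∈ range N ×ˢ range N,
      if s.1 + s.2 = m then α s.1 (x s.2) else 0 := by
  rw [seriesApply, sum_range_eq_box h (fun i j => α i (x j))]
  simp only [sum_product]

theorem sum_box3_swap {M : Type*} [AddCommMonoid M] (N : ℕ) (F : ℕ → ℕ → ℕ → M) :
    ∑ w ∈ box3 N, F w.1 w.2.1 w.2.2 = ∑ w ∈ box3 N, F w.2.1 w.1 w.2.2 := by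
  simp only [box3, sum_product]
  exact sum_comm

theorem seriesMul_seriesMul_seriesApply (ν : ℕ → (A →ₗ[K] A →ₗ[K] A)) (α : ℕ → (A →ₗ[K] A))
    {n N : ℕ} (h : n < N) (x y z : ℕ → A) :
    seriesMul ν (seriesMul ν x y) (seriesApply α z) n = ∑ w ∈ box3 N, ∑ t ∈ box3 N,
      if t.1 + t.2.1 + t.2.2 + (w.1 + w.2.1 + w.2.2) = n then
        ν t.1 (ν t.2.1 (x w.1) (y w.2.1)) (α t.2.2 (z w.2.2)) else 0 := by
  rw [seriesMul_eq_sum_family h (fun m hm => seriesMul_eq_sum_box3 hm x y)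
    (fun m hm => seriesApply_eq_sum_box hm z)]
  conv_rhs => rw [sum_comm]
  simp only [box3, sum_product]
  refine sum_congr rfl fun i _ => sum_congr rfl fun j _ => ?_
  refine ((sum_congr rfl fun p _ => sum_comm).trans sum_comm).trans ?_
  refine sum_congr rfl fun k _ => sum_congr rfl fun p _ => sum_congr rfl fun q _ =>
    sum_congr rfl fun r _ => if_congr (by omega) rfl rfl

theorem seriesMul_seriesApply_seriesMul (ν : ℕ → (A →ₗ[K] A →ₗ[K] A)) (α : ℕ → (A →ₗ[K] A))
    {n N : ℕ} (h : n < N) (x y z : ℕ → A) :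
    seriesMul ν (seriesApply α x) (seriesMul ν y z) n = ∑ w ∈ box3 N, ∑ t ∈ box3 N,
      if t.1 + t.2.1 + t.2.2 + (w.1 + w.2.1 + w.2.2) = n then
        ν t.1 (α t.2.1 (x w.1)) (ν t.2.2 (y w.2.1) (z w.2.2)) else 0 := by
  rw [seriesMul_eq_sum_family h (fun m hm => seriesApply_eq_sum_box hm x)
    (fun m hm => seriesMul_eq_sum_box3 hm y z)]
  conv_rhs => rw [sum_comm]
  simp only [box3, sum_product]
  refine sum_congr rfl fun i _ => sum_congr rfl fun j _ => ?_
  refine sum_comm.trans ?_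
  refine sum_congr rfl fun k _ => sum_congr rfl fun p _ => sum_congr rfl fun q _ =>
    sum_congr rfl fun r _ => if_congr (by omega) rfl rfl

theorem seriesMul_seriesApply_seriesApply (ν : ℕ → (A →ₗ[K] A →ₗ[K] A)) (α : ℕ → (A →ₗ[K] A))
    {n N : ℕ} (h : n < N) (x y : ℕ → A) :
    seriesMul ν (seriesApply α x) (seriesApply α y) n =
      ∑ w ∈ range N ×ˢ range N, ∑ t ∈ box3 N,
        if t.1 + t.2.1 + t.2.2 + (w.1 + w.2) = n then
          ν t.1 (α t.2.1 (x w.1)) (α t.2.2 (y w.2)) else 0 := by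
  rw [seriesMul_eq_sum_family h (fun m hm => seriesApply_eq_sum_box hm x)
    (fun m hm => seriesApply_eq_sum_box hm y)]
  conv_rhs => rw [sum_comm]
  simp only [box3, sum_product]
  refine sum_congr rfl fun i _ => sum_congr rfl fun j _ => ?_
  refine sum_comm.trans ?_
  refine sum_congr rfl fun k _ => sum_congr rfl fun p _ => sum_congr rfl fun q _ =>
    if_congr (by omega) rfl rfl

theorem seriesApply_seriesMul (ν : ℕ → (A →ₗ[K] A →ₗ[K] A)) (α : ℕ → (A →ₗ[K] A))
    {n N : ℕ} (h : n < N) (x y : ℕ → A) :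
    seriesApply α (seriesMul ν x y) n =
      ∑ w ∈ range N ×ˢ range N, ∑ t ∈ range N ×ˢ range N,
        if t.1 + t.2 + (w.1 + w.2) = n then α t.1 (ν t.2 (x w.1) (y w.2)) else 0 := by
  rw [seriesApply_eq_sum_family h (fun m hm => seriesMul_eq_sum_box3 hm x y)]
  conv_rhs => rw [sum_comm]
  simp only [box3, sum_product]
  refine sum_congr rfl fun i _ => sum_congr rfl fun j _ => sum_congr rfl fun p _ =>
    sum_congr rfl fun q _ => if_congr (by omega) rfl rfl

/-- The deformed Hom-pre-Lie identity holds for formal series with coefficients in `W` once it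
holds for elements of `W`. -/
theorem series_homPreLie {ν : ℕ → (A →ₗ[K] A →ₗ[K] A)} {α : ℕ → (A →ₗ[K] A)} {W : Set A}
    (hW : ∀ (n : ℕ) (a b c : A), a ∈ W → b ∈ W → c ∈ W →
      (∑ i ∈ range (n + 1), ∑ j ∈ range (n + 1 - i),
        (ν i (ν j a b) (α (n - i - j) c) - ν i (α j a) (ν (n - i - j) b c)
          - ν i (ν j b a) (α (n - i - j) c) + ν i (α j b) (ν (n - i - j) a c))) = 0)
    {x y z : ℕ → A} (hx : ∀ i, x i ∈ W) (hy : ∀ i, y i ∈ W) (hz : ∀ i, z i ∈ W) (n : ℕ) :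
    seriesMul ν (seriesMul ν x y) (seriesApply α z) n
      - seriesMul ν (seriesApply α x) (seriesMul ν y z) n
      - seriesMul ν (seriesMul ν y x) (seriesApply α z) n
      + seriesMul ν (seriesApply α y) (seriesMul ν x z) n = 0 := by
  have h := n.lt_succ_self
  rw [seriesMul_seriesMul_seriesApply ν α h x y z, seriesMul_seriesApply_seriesMul ν α h x y z,
    seriesMul_seriesMul_seriesApply ν α h y x z, seriesMul_seriesApply_seriesMul ν α h y x z,
    sum_box3_swap _ (fun p q r => ∑ t ∈ box3 (n + 1), if t.1 + t.2.1 + t.2.2 + (p + q + r) = n then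
        ν t.1 (ν t.2.1 (y p) (x q)) (α t.2.2 (z r)) else 0),
    sum_box3_swap _ (fun p q r => ∑ t ∈ box3 (n + 1), if t.1 + t.2.1 + t.2.2 + (p + q + r) = n then
        ν t.1 (α t.2.1 (y p)) (ν t.2.2 (x q) (z r)) else 0)]
  simp only [← sum_sub_distrib, ← sum_add_distrib]
  refine sum_eq_zero fun w _ => ?_
  rcases le_or_gt (w.1 + w.2.1 + w.2.2) n with hw | hw
  · have hm : n - (w.1 + w.2.1 + w.2.2) < n + 1 := by omega
    have hm0 := hW (n - (w.1 + w.2.1 + w.2.2)) _ _ _ (hx w.1) (hy w.2.1) (hz w.2.2)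
    rw [sum_range_range_eq_box hm (fun i j k => ν i (ν j (x w.1) (y w.2.1)) (α k (z w.2.2))
        - ν i (α j (x w.1)) (ν k (y w.2.1) (z w.2.2))
        - ν i (ν j (y w.2.1) (x w.1)) (α k (z w.2.2))
        + ν i (α j (y w.2.1)) (ν k (x w.1) (z w.2.2)))] at hm0
    refine Eq.trans ?_ hm0
    simp only [box3, sum_product]
    refine sum_congr rfl fun i _ => sum_congr rfl fun j _ => sum_congr rfl fun k _ => ?_
    by_cases hs : i + j + k = n - (w.1 + w.2.1 + w.2.2)
    · simp only [if_pos hs, if_pos (show i + j + k + (w.1 + w.2.1 + w.2.2) = n by omega),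
        if_pos (show i + j + k + (w.2.1 + w.1 + w.2.2) = n by omega)]
    · simp only [if_neg hs, if_neg (show i + j + k + (w.1 + w.2.1 + w.2.2) ≠ n by omega),
        if_neg (show i + j + k + (w.2.1 + w.1 + w.2.2) ≠ n by omega), sub_zero, add_zero]
  · refine sum_eq_zero fun t _ => ?_
    simp only [if_neg (show t.1 + t.2.1 + t.2.2 + (w.1 + w.2.1 + w.2.2) ≠ n by omega),
      if_neg (show t.1 + t.2.1 + t.2.2 + (w.2.1 + w.1 + w.2.2) ≠ n by omega), sub_zero, add_zero]

/-- The deformed multiplicativity of `α` holds for formal series with coefficients in `W` once it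
holds for elements of `W`. -/
theorem series_alpha_mult {ν : ℕ → (A →ₗ[K] A →ₗ[K] A)} {α : ℕ → (A →ₗ[K] A)} {W : Set A}
    (hW : ∀ (n : ℕ) (a b : A), a ∈ W → b ∈ W →
      (∑ i ∈ range (n + 1), ∑ j ∈ range (n + 1 - i), ν i (α j a) (α (n - i - j) b))
        = ∑ i ∈ range (n + 1), α i (ν (n - i) a b))
    {x y : ℕ → A} (hx : ∀ i, x i ∈ W) (hy : ∀ i, y i ∈ W) (n : ℕ) :
    seriesMul ν (seriesApply α x) (seriesApply α y) n = seriesApply α (seriesMul ν x y) n := by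
  have h := n.lt_succ_self
  rw [seriesMul_seriesApply_seriesApply ν α h, seriesApply_seriesMul ν α h]
  refine sum_congr rfl fun w _ => ?_
  rcases le_or_gt (w.1 + w.2) n with hw | hw
  · have hm : n - (w.1 + w.2) < n + 1 := by omega
    have := hW (n - (w.1 + w.2)) _ _ (hx w.1) (hy w.2)
    rw [sum_range_range_eq_box hm (fun i j k => ν i (α j (x w.1)) (α k (y w.2))),
      sum_range_eq_box hm (fun i j => α i (ν j (x w.1) (y w.2)))] at this
    simp only [box3, sum_product]
    refine Eq.trans ?_ (this.trans ?_)
    · exact sum_congr rfl fun i _ => sum_congr rfl fun j _ => sum_congr rfl fun k _ =>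
        if_congr (by omega) rfl rfl
    · exact sum_congr rfl fun i _ => sum_congr rfl fun j _ => if_congr (by omega) rfl rfl
  · rw [sum_eq_zero fun t _ => if_neg (by omega), sum_eq_zero fun t _ => if_neg (by omega)]

/-- The first obstruction to extending a formal isomorphism `ψ_t` onto the undeformed algebra is
an α-type 2-cocycle. -/
theorem obstruction_cocycle (S : HomPreLieStr K A) {ν : ℕ → (A →ₗ[K] A →ₗ[K] A)}
    {α : ℕ → (A →ₗ[K] A)} {W : Set A}
    (hν0 : ∀ a b : A, a ∈ W → b ∈ W → ν 0 a b = S.mul a b)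
    (hα0 : ∀ a : A, a ∈ W → α 0 a = S.alpha a)
    (hWmul : ∀ a b : A, a ∈ W → b ∈ W → S.mul a b ∈ W)
    (hWalpha : ∀ a : A, a ∈ W → S.alpha a ∈ W)
    (hdeform : ∀ (n : ℕ) (a b c : A), a ∈ W → b ∈ W → c ∈ W →
      (∑ i ∈ range (n + 1), ∑ j ∈ range (n + 1 - i),
        (ν i (ν j a b) (α (n - i - j) c) - ν i (α j a) (ν (n - i - j) b c)
          - ν i (ν j b a) (α (n - i - j) c) + ν i (α j b) (ν (n - i - j) a c))) = 0)
    (hdeform_alpha : ∀ (n : ℕ) (a b : A), a ∈ W → b ∈ W →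
      (∑ i ∈ range (n + 1), ∑ j ∈ range (n + 1 - i), ν i (α j a) (α (n - i - j) b))
        = ∑ i ∈ range (n + 1), α i (ν (n - i) a b))
    {ψ : ℕ → (A →ₗ[K] A)} {n : ℕ} (hn : n ≠ 0)
    (hψW : ∀ (i : ℕ) (a : A), a ∈ W → ψ i a ∈ W) (hψ0 : ∀ a ∈ W, ψ 0 a = a)
    (hψn : ψ n = 0)
    (hmul : ∀ m < n, ∀ a b : A, a ∈ W → b ∈ W →
      seriesMul ν (fun i => ψ i a) (fun i => ψ i b) m = ψ m (S.mul a b))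
    (halpha : ∀ m < n, ∀ a ∈ W, seriesApply α (fun i => ψ i a) m = ψ m (S.alpha a))
    {E : A →ₗ[K] A →ₗ[K] A} {F : A →ₗ[K] A}
    (hE : ∀ a b : A, E a b = seriesMul ν (fun i => ψ i a) (fun i => ψ i b) n)
    (hF : ∀ a : A, F a = seriesApply α (fun i => ψ i a) n)
    (hEW : ∀ a b : A, a ∈ W → b ∈ W → E a b ∈ W) (hFW : ∀ a ∈ W, F a ∈ W) :
    (∀ a b c : A, a ∈ W → b ∈ W → c ∈ W → Dnn2 S E a b c - Dan2 S F a b c = 0) ∧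
      ∀ a b : A, a ∈ W → b ∈ W → Dna2 S E a b - Daa2 S F a b = 0 := by
  have hL : ∀ a b c : A, a ∈ W → b ∈ W → c ∈ W →
      seriesMul ν (seriesMul ν (fun i => ψ i a) (fun i => ψ i b)) (seriesApply α fun i => ψ i c) n
        = E (S.mul a b) (S.alpha c) + S.mul (E a b) (S.alpha c) + S.mul (S.mul a b) (F c) := by
    intro a b c ha hb hc
    rw [seriesMul_eq_add hn (fun m hm => hmul m hm a b ha hb) (fun m hm => halpha m hm c hc),
      ← hE, ← hE, ← hF, hψn, hψ0 _ (hWmul a b ha hb), hψ0 _ (hWalpha c hc)]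
    simp only [LinearMap.zero_apply, sub_zero]
    rw [hν0 _ _ (hEW a b ha hb) (hWalpha c hc), hν0 _ _ (hWmul a b ha hb) (hFW c hc)]
  have hR : ∀ a b c : A, a ∈ W → b ∈ W → c ∈ W →
      seriesMul ν (seriesApply α fun i => ψ i a) (seriesMul ν (fun i => ψ i b) (fun i => ψ i c)) n
        = E (S.alpha a) (S.mul b c) + S.mul (F a) (S.mul b c) + S.mul (S.alpha a) (E b c) := by
    intro a b c ha hb hc
    rw [seriesMul_eq_add hn (fun m hm => halpha m hm a ha) (fun m hm => hmul m hm b c hb hc),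
      ← hE, ← hE, ← hF, hψn, hψ0 _ (hWmul b c hb hc), hψ0 _ (hWalpha a ha)]
    simp only [LinearMap.zero_apply, sub_zero]
    rw [hν0 _ _ (hFW a ha) (hWmul b c hb hc), hν0 _ _ (hWalpha a ha) (hEW b c hb hc)]
  constructor
  · intro a b c ha hb hc
    have key := series_homPreLie hdeform (fun i => hψW i a ha) (fun i => hψW i b hb)
      (fun i => hψW i c hc) n
    rw [hL a b c ha hb hc, hR a b c ha hb hc, hL b a c hb ha hc, hR b a c hb ha hc] at key
    rw [Dnn2, Dan2, ← neg_eq_zero, ← key]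
    abel
  · intro a b ha hb
    have key := series_alpha_mult hdeform_alpha (fun i => hψW i a ha) (fun i => hψW i b hb) n
    rw [seriesMul_eq_add hn (fun m hm => halpha m hm a ha) (fun m hm => halpha m hm b hb),
      seriesApply_eq_add (fun m hm => hmul m hm a b ha hb), ← hE, ← hE, ← hF, ← hF, ← hF, hψn,
      hψ0 _ (hWalpha a ha), hψ0 _ (hWalpha b hb)] at key
    simp only [LinearMap.zero_apply, sub_zero] at key
    rw [hν0 _ _ (hFW a ha) (hWalpha b hb), hν0 _ _ (hWalpha a ha) (hFW b hb),
      hα0 _ (hEW a b ha hb)] at key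
    rw [Dna2, Daa2, ← neg_eq_zero, ← sub_eq_zero.2 key]
    abel

end FormalSeries

section Equivariant

variable {K A : Type} [Field K] [AddCommGroup A] [Module K A] {S : HomPreLieStr K A}
  {G : Type} [Group G] {act : HPLAction S G}

/-- The fixed points of a subgroup as a submodule. -/
def HPLAction.fxSubmodule (act : HPLAction S G) (H : Subgroup G) : Submodule K A where
  carrier := act.fx H
  add_mem' ha hb h hh := by rw [map_add, ha h hh, hb h hh]
  zero_mem' _ _ := map_zero _
  smul_mem' c a ha h hh := by rw [map_smul, ha h hh]

theorem HPLAction.sum_mem_fx {ι : Type*} {H : Subgroup G} {s : Finset ι} {f : ι → A}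
    (hf : ∀ i ∈ s, f i ∈ act.fx H) : ∑ i ∈ s, f i ∈ act.fx H :=
  (act.fxSubmodule H).sum_mem hf

theorem HPLAction.mul_mem_fx {H : Subgroup G} {a b : A} (ha : a ∈ act.fx H) (hb : b ∈ act.fx H) :
    S.mul a b ∈ act.fx H := fun h hh => by rw [act.psi_mul, ha h hh, hb h hh]

theorem HPLAction.alpha_mem_fx {H : Subgroup G} {a : A} (ha : a ∈ act.fx H) :
    S.alpha a ∈ act.fx H := fun h hh => by rw [← act.psi_alpha, ha h hh]

theorem HPLAction.zero_mem_fx {H : Subgroup G} : (0 : A) ∈ act.fx H :=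
  (act.fxSubmodule H).zero_mem

theorem HPLAction.neg_mem_fx {H : Subgroup G} {a : A} (ha : a ∈ act.fx H) : -a ∈ act.fx H :=
  (act.fxSubmodule H).neg_mem ha

/-- The equivariant deformation all of whose higher terms vanish. -/
def EquivFormalDef.trivial (act : HPLAction S G) : EquivFormalDef S act where
  nu _ i := if i = 0 then S.mul else 0
  al _ i := if i = 0 then S.alpha else 0
  nu_zero _ _ _ _ _ := rfl
  al_zero _ _ _ := rfl
  maps_nu H i a b ha hb := by
    split_ifs
    · exact act.mul_mem_fx ha hb
    · exact act.zero_mem_fx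
  maps_al H i a ha := by
    split_ifs
    · exact act.alpha_mem_fx ha
    · exact act.zero_mem_fx
  deform H n a b c _ _ _ := by
    rcases Nat.eq_zero_or_pos n with rfl | hn
    · simp [S.homPreLie a b c]
    · refine sum_eq_zero fun i _ => sum_eq_zero fun j _ => ?_
      by_cases hi : i = 0
      · by_cases hj : j = 0
        · simp [hi, hj, hn.ne']
        · simp [hj]
      · simp [hi]
  deform_alpha H n a b _ _ := by
    rcases Nat.eq_zero_or_pos n with rfl | hn
    · simp [S.alpha_mult]
    · rw [sum_eq_zero fun i _ => sum_eq_zero fun j _ => ?_, sum_eq_zero fun i _ => ?_]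
      · by_cases hi : i = 0
        · simp [hi, hn.ne']
        · simp [hi]
      · by_cases hi : i = 0
        · by_cases hj : j = 0
          · simp [hi, hj, hn.ne']
          · simp [hj]
        · simp [hi]
  equivar_nu g H K' _ i a b _ _ := by
    split_ifs
    · exact (act.psi_mul g a b).symm
    · simp
  equivar_al g H K' _ i a _ := by
    split_ifs
    · exact act.psi_alpha g a
    · simp

/-- Every invariant family of α-type 2-cocycles is an invariant 2-coboundary. -/
def EquivH2Vanishes (act : HPLAction S G) : Prop :=
  ∀ (ν' : Subgroup G → (A →ₗ[K] A →ₗ[K] A)) (α' : Subgroup G → (A →ₗ[K] A)),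
    (∀ (H : Subgroup G) (a b : A), a ∈ act.fx H → b ∈ act.fx H → ν' H a b ∈ act.fx H) →
    (∀ (H : Subgroup G) (a : A), a ∈ act.fx H → α' H a ∈ act.fx H) →
    (∀ (g : G) (H K' : Subgroup G), (∀ h ∈ H, g⁻¹ * h * g ∈ K') →
      ∀ a b : A, a ∈ act.fx K' → b ∈ act.fx K' →
        ν' H (act.psi g a) (act.psi g b) = act.psi g (ν' K' a b)) →
    (∀ (g : G) (H K' : Subgroup G), (∀ h ∈ H, g⁻¹ * h * g ∈ K') →
      ∀ a : A, a ∈ act.fx K' → α' H (act.psi g a) = act.psi g (α' K' a)) →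
    (∀ (H : Subgroup G) (a b c : A), a ∈ act.fx H → b ∈ act.fx H → c ∈ act.fx H →
      Dnn2 S (ν' H) a b c - Dan2 S (α' H) a b c = 0) →
    (∀ (H : Subgroup G) (a b : A), a ∈ act.fx H → b ∈ act.fx H →
      Dna2 S (ν' H) a b - Daa2 S (α' H) a b = 0) →
    ∃ φ : Subgroup G → (A →ₗ[K] A),
      (∀ (H : Subgroup G) (a : A), a ∈ act.fx H → φ H a ∈ act.fx H) ∧
      (∀ (g : G) (H K' : Subgroup G), (∀ h ∈ H, g⁻¹ * h * g ∈ K') →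
        ∀ a : A, a ∈ act.fx K' → φ H (act.psi g a) = act.psi g (φ K' a)) ∧
      (∀ (H : Subgroup G) (a b : A), a ∈ act.fx H → b ∈ act.fx H → ν' H a b = Dnn1 S (φ H) a b) ∧
      (∀ (H : Subgroup G) (a : A), a ∈ act.fx H → α' H a = Dna1 S (φ H) a)

/-- `Ψ` is polynomial of degree less than `n` and is an equivariant equivalence of `D` with the
trivial deformation modulo `t^n`. -/
structure IsTrivializationBelow (D : EquivFormalDef S act) (n : ℕ)
    (Ψ : Subgroup G → ℕ → (A →ₗ[K] A)) : Prop where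
  zero : ∀ H, Ψ H 0 = LinearMap.id
  maps : ∀ (H : Subgroup G) (i : ℕ) (a : A), a ∈ act.fx H → Ψ H i a ∈ act.fx H
  equivar : ∀ (g : G) (H K' : Subgroup G), (∀ h ∈ H, g⁻¹ * h * g ∈ K') →
    ∀ (i : ℕ) (a : A), a ∈ act.fx K' → Ψ H i (act.psi g a) = act.psi g (Ψ K' i a)
  mul : ∀ (H : Subgroup G), ∀ m < n, ∀ a b : A, a ∈ act.fx H → b ∈ act.fx H →
    seriesMul (D.nu H) (fun i => Ψ H i a) (fun i => Ψ H i b) m = Ψ H m (S.mul a b)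
  alpha : ∀ (H : Subgroup G), ∀ m < n, ∀ a ∈ act.fx H,
    seriesApply (D.al H) (fun i => Ψ H i a) m = Ψ H m (S.alpha a)
  eq_zero : ∀ (H : Subgroup G), ∀ m ≥ n, Ψ H m = 0

theorem isTrivializationBelow_one (D : EquivFormalDef S act) :
    IsTrivializationBelow D 1 fun _ i => if i = 0 then LinearMap.id else 0 where
  zero _ := rfl
  maps H i a ha := by
    split_ifs
    · exact ha
    · exact act.zero_mem_fx
  equivar g H K' _ i a _ := by split_ifs <;> simp
  mul H m hm a b ha hb := by
    obtain rfl : m = 0 := by omega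
    simp [seriesMul, D.nu_zero H a b ha hb]
  alpha H m hm a ha := by
    obtain rfl : m = 0 := by omega
    simp [seriesApply, D.al_zero H a ha]
  eq_zero H m hm := if_neg (by omega)

theorem IsTrivializationBelow.exists_succ (h2 : EquivH2Vanishes act) {D : EquivFormalDef S act}
    {n : ℕ} (hn : n ≠ 0) {Ψ : Subgroup G → ℕ → (A →ₗ[K] A)} (hΨ : IsTrivializationBelow D n Ψ) :
    ∃ Ψ' : Subgroup G → ℕ → (A →ₗ[K] A),
      IsTrivializationBelow D (n + 1) Ψ' ∧ ∀ H, ∀ m < n, Ψ' H m = Ψ H m := by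
  let E : Subgroup G → (A →ₗ[K] A →ₗ[K] A) := fun H => ∑ i ∈ range (n + 1),
    ∑ j ∈ range (n + 1 - i), (D.nu H i).compl₁₂ (Ψ H j) (Ψ H (n - i - j))
  let F : Subgroup G → (A →ₗ[K] A) := fun H => ∑ i ∈ range (n + 1), D.al H i ∘ₗ Ψ H (n - i)
  have hE : ∀ H a b, E H a b = seriesMul (D.nu H) (fun i => Ψ H i a) (fun i => Ψ H i b) n := by
    intro H a b
    simp [E, seriesMul, LinearMap.sum_apply]
  have hF : ∀ H a, F H a = seriesApply (D.al H) (fun i => Ψ H i a) n := by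
    intro H a
    simp [F, seriesApply, LinearMap.sum_apply]
  have hEfx : ∀ H a b, a ∈ act.fx H → b ∈ act.fx H → E H a b ∈ act.fx H := by
    intro H a b ha hb
    rw [hE]
    exact act.sum_mem_fx fun i _ => act.sum_mem_fx fun j _ =>
      D.maps_nu H i _ _ (hΨ.maps H _ a ha) (hΨ.maps H _ b hb)
  have hFfx : ∀ H a, a ∈ act.fx H → F H a ∈ act.fx H := by
    intro H a ha
    rw [hF]
    exact act.sum_mem_fx fun i _ => D.maps_al H i _ (hΨ.maps H _ a ha)
  have hcocycle := fun H : Subgroup G => obstruction_cocycle S (W := act.fx H) (D.nu_zero H)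
    (D.al_zero H) (fun _ _ => act.mul_mem_fx) (fun _ => act.alpha_mem_fx) (D.deform H)
    (D.deform_alpha H) hn (hΨ.maps H) (fun a _ => by rw [hΨ.zero]; rfl) (hΨ.eq_zero H n le_rfl)
    (hΨ.mul H) (hΨ.alpha H) (hE H) (hF H) (hEfx H) (hFfx H)
  obtain ⟨φ, hφfx, hφequivar, hEφ, hFφ⟩ := h2 E F hEfx hFfx
    (by
      intro g H K' hg a b ha hb
      simp only [hE, seriesMul, map_sum]
      refine sum_congr rfl fun i _ => sum_congr rfl fun j _ => ?_
      rw [hΨ.equivar g H K' hg _ a ha, hΨ.equivar g H K' hg _ b hb,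
        D.equivar_nu g H K' hg _ _ _ (hΨ.maps _ _ a ha) (hΨ.maps _ _ b hb)])
    (by
      intro g H K' hg a ha
      simp only [hF, seriesApply, map_sum]
      refine sum_congr rfl fun i _ => ?_
      rw [hΨ.equivar g H K' hg _ a ha, D.equivar_al g H K' hg _ _ (hΨ.maps _ _ a ha)])
    (fun H => (hcocycle H).1) (fun H => (hcocycle H).2)
  have hlt : ∀ H, ∀ m < n, Function.update (Ψ H) n (-φ H) m = Ψ H m :=
    fun H m hm => Function.update_of_ne hm.ne _ _
  have hzero : ∀ H, Function.update (Ψ H) n (-φ H) 0 = LinearMap.id :=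
    fun H => (hlt H 0 (Nat.pos_of_ne_zero hn)).trans (hΨ.zero H)
  refine ⟨fun H => Function.update (Ψ H) n (-φ H), ⟨hzero, ?_, ?_, ?_, ?_, ?_⟩, hlt⟩
  · intro H i a ha
    rcases eq_or_ne i n with rfl | hi
    · simpa using act.neg_mem_fx (hφfx H a ha)
    · simpa [hi] using hΨ.maps H i a ha
  · intro g H K' hg i a ha
    rcases eq_or_ne i n with rfl | hi
    · simp [hφequivar g H K' hg a ha]
    · simp [hi, hΨ.equivar g H K' hg i a ha]
  · intro H m hm a b ha hb
    rcases Nat.lt_succ_iff_lt_or_eq.1 hm with hm | rfl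
    · rw [hlt H m hm, ← hΨ.mul H m hm a b ha hb]
      exact seriesMul_congr (fun k hk => by rw [hlt H k (by omega)])
        (fun k hk => by rw [hlt H k (by omega)])
    · rw [seriesMul_eq_add hn (x' := fun i => Ψ H i a) (y' := fun i => Ψ H i b)
        (fun k hk => by rw [hlt H k hk]) (fun k hk => by rw [hlt H k hk]), ← hE, hEφ H a b ha hb,
        hΨ.zero, hΨ.eq_zero H m le_rfl]
      simp [Dnn1, D.nu_zero H _ _ (hφfx H a ha) hb, D.nu_zero H _ _ ha (hφfx H b hb)]
      abel
  · intro H m hm a ha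
    rcases Nat.lt_succ_iff_lt_or_eq.1 hm with hm | rfl
    · rw [hlt H m hm, ← hΨ.alpha H m hm a ha]
      exact seriesApply_congr (fun k hk => by rw [hlt H k (by omega)])
    · rw [seriesApply_eq_add (x' := fun i => Ψ H i a) (fun k hk => by rw [hlt H k hk]), ← hF,
        hFφ H a ha, hΨ.eq_zero H m le_rfl]
      simp [Dna1, D.al_zero H _ (hφfx H a ha)]
      abel
  · intro H m hm
    exact (Function.update_of_ne (by omega) _ _).trans (hΨ.eq_zero H m (by omega))

/-- Trivializations modulo every power of `t` can be chosen coherently, and their limit satisfies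
the equations in all orders. -/
theorem exists_trivialization (h2 : EquivH2Vanishes act) (D : EquivFormalDef S act) :
    ∃ Ψ : Subgroup G → ℕ → (A →ₗ[K] A),
      (∀ H, Ψ H 0 = LinearMap.id) ∧
      (∀ (g : G) (H K' : Subgroup G), (∀ h ∈ H, g⁻¹ * h * g ∈ K') →
        ∀ (i : ℕ) (a : A), a ∈ act.fx K' → Ψ H i (act.psi g a) = act.psi g (Ψ K' i a)) ∧
      (∀ (H : Subgroup G) (m : ℕ) (a b : A), a ∈ act.fx H → b ∈ act.fx H →
        seriesMul (D.nu H) (fun i => Ψ H i a) (fun i => Ψ H i b) m = Ψ H m (S.mul a b)) ∧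
      (∀ (H : Subgroup G) (m : ℕ), ∀ a ∈ act.fx H,
        seriesApply (D.al H) (fun i => Ψ H i a) m = Ψ H m (S.alpha a)) := by
  choose next hnext hagree using
    fun (n : ℕ) (Ψ : {Ψ // IsTrivializationBelow D (n + 1) Ψ}) => Ψ.2.exists_succ h2 n.succ_ne_zero
  let s : ∀ n, {Ψ // IsTrivializationBelow D (n + 1) Ψ} := fun n =>
    Nat.rec ⟨_, isTrivializationBelow_one D⟩ (fun n Ψ => ⟨next n Ψ, hnext n Ψ⟩) n
  have hs : ∀ H m k, (s (m + k)).1 H m = (s m).1 H m := by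
    intro H m k
    induction k with
    | zero => rfl
    | succ k ih => exact (hagree (m + k) (s (m + k)) H m (by omega)).trans ih
  have hs' : ∀ H, ∀ n, ∀ m ≤ n, (s m).1 H m = (s n).1 H m := by
    intro H n m hm
    obtain ⟨k, rfl⟩ := Nat.exists_eq_add_of_le hm
    exact (hs H m k).symm
  refine ⟨fun H m => (s m).1 H m, fun H => (s 0).2.zero H,
    fun g H K' hg i => (s i).2.equivar g H K' hg i, fun H m a b ha hb => ?_, fun H m a ha => ?_⟩
  · rw [← (s m).2.mul H m m.lt_succ_self a b ha hb]
    exact seriesMul_congr (fun k hk => LinearMap.congr_fun (hs' H m k hk) _) (fun k hk => LinearMap.congr_fun (hs' H m k hk) _)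
  · rw [← (s m).2.alpha H m m.lt_succ_self a ha]
    exact seriesApply_congr (fun k hk => LinearMap.congr_fun (hs' H m k hk) _)

end Equivariant

/-- Equivariant rigidity: if every invariant family of α-type 2-cocycles
`{(ν'^H, α'^H)}_{H ≤ G}` (valued in the fixed-point subalgebras) is an invariant
2-coboundary `{(∂̃_{νν}φ^H, ∂̃_{να}φ^H)}`, then every equivariant formal
deformation of `A` is equivalent, through an equivariant equivalence, to the
trivial equivariant deformation. -/
theorem equivariant_rigidity (K A G : Type) [Field K] [CharZero K]
    [AddCommGroup A] [Module K A] [Group G] [Fintype G]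
    (S : HomPreLieStr K A) (act : HPLAction S G)
    (h2 : ∀ (ν' : Subgroup G → (A →ₗ[K] A →ₗ[K] A)) (α' : Subgroup G → (A →ₗ[K] A)),
      (∀ (H : Subgroup G) (a b : A), a ∈ act.fx H → b ∈ act.fx H →
        ν' H a b ∈ act.fx H) →
      (∀ (H : Subgroup G) (a : A), a ∈ act.fx H → α' H a ∈ act.fx H) →
      (∀ (g : G) (H K' : Subgroup G), (∀ h ∈ H, g⁻¹ * h * g ∈ K') →
        ∀ a b : A, a ∈ act.fx K' → b ∈ act.fx K' →
          ν' H (act.psi g a) (act.psi g b) = act.psi g (ν' K' a b)) →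
      (∀ (g : G) (H K' : Subgroup G), (∀ h ∈ H, g⁻¹ * h * g ∈ K') →
        ∀ a : A, a ∈ act.fx K' → α' H (act.psi g a) = act.psi g (α' K' a)) →
      (∀ (H : Subgroup G) (a b c : A),
        a ∈ act.fx H → b ∈ act.fx H → c ∈ act.fx H →
          Dnn2 S (ν' H) a b c - Dan2 S (α' H) a b c = 0) →
      (∀ (H : Subgroup G) (a b : A), a ∈ act.fx H → b ∈ act.fx H →
          Dna2 S (ν' H) a b - Daa2 S (α' H) a b = 0) →
      ∃ φ : Subgroup G → (A →ₗ[K] A),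
        (∀ (H : Subgroup G) (a : A), a ∈ act.fx H → φ H a ∈ act.fx H) ∧
        (∀ (g : G) (H K' : Subgroup G), (∀ h ∈ H, g⁻¹ * h * g ∈ K') →
          ∀ a : A, a ∈ act.fx K' → φ H (act.psi g a) = act.psi g (φ K' a)) ∧
        (∀ (H : Subgroup G) (a b : A), a ∈ act.fx H → b ∈ act.fx H →
          ν' H a b = Dnn1 S (φ H) a b) ∧
        (∀ (H : Subgroup G) (a : A), a ∈ act.fx H → α' H a = Dna1 S (φ H) a)) :
    ∀ D : EquivFormalDef S act,
      ∃ (D' : EquivFormalDef S act) (Ψ : Subgroup G → ℕ → (A →ₗ[K] A)),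
        (∀ (H : Subgroup G) (i : ℕ), 1 ≤ i →
          (∀ a b : A, a ∈ act.fx H → b ∈ act.fx H → D'.nu H i a b = 0) ∧
          (∀ a : A, a ∈ act.fx H → D'.al H i a = 0)) ∧
        EquivAreEquiv D D' Ψ ∧
        (∀ (g : G) (H K' : Subgroup G), (∀ h ∈ H, g⁻¹ * h * g ∈ K') →
          ∀ (i : ℕ) (a : A), a ∈ act.fx K' →
            Ψ H i (act.psi g a) = act.psi g (Ψ K' i a)) := by
  intro D
  obtain ⟨Ψ, hzero, hequivar, hmul, halpha⟩ := exists_trivialization h2 D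
  refine ⟨EquivFormalDef.trivial act, Ψ, fun H i hi => ?_,
    ⟨fun H a _ => by rw [hzero]; rfl, fun H n a b ha hb => ?_, fun H n a ha => ?_⟩, hequivar⟩
  · have hi : i ≠ 0 := by omega
    exact ⟨fun a b _ _ => by simp [EquivFormalDef.trivial, hi],
      fun a _ => by simp [EquivFormalDef.trivial, hi]⟩
  · refine Eq.trans ?_ (hmul H n a b ha hb).symm
    rw [sum_range_succ, sum_eq_zero fun i hi => ?_]
    · simp [EquivFormalDef.trivial]
    · have : n - i ≠ 0 := by
        rw [mem_range] at hi
        omega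
      simp [EquivFormalDef.trivial, this]
  · refine (halpha H n a ha).trans ?_
    rw [sum_range_succ, sum_eq_zero fun i hi => ?_]
    · simp [EquivFormalDef.trivial]
    · have : n - i ≠ 0 := by
        rw [mem_range] at hi
        omega
      simp [EquivFormalDef.trivial, this]
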